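/- Monogamy of Gaussian steerability with respect to the steering party: let V be a real symmetric positive definite quantum covariance matrix on subsystems A, B_1, …, B_k (i.e., V + i·Ω positive semidefinite, Ω the direct sum of the standard symplectic forms of the subsystems). Then g_-(V/V_A) ≥ Σ_{j=1}^k g_-(V_{AB_j}/V_A); that is, G(A⟩B_1…B_k) ≥ Σ_j G(A⟩B_j), where G(A⟩X) = g_-(V_{AX}/V_A) is the Gaussian steerability of X by A. -/

import Mathlib

open Matrix
open scoped ComplexOrder Kronecker

noncomputable section

/-- The standard symplectic form on a single mode. -/
def J2 : Matrix (Fin 2) (Fin 2) ℝ := !![0, 1; -1, 0]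

/-- The standard symplectic form on `n` modes: the direct sum of `n` copies of
`[[0,1],[-1,0]]`, realized on the index type `Fin n × Fin 2`. -/
def Omega (n : ℕ) : Matrix (Fin n × Fin 2) (Fin n × Fin 2) ℝ :=
  (1 : Matrix (Fin n) (Fin n) ℝ) ⊗ₖ J2

/-- `V` is a quantum covariance matrix with respect to the symplectic form `Om`:
the complex matrix `V + i·Om` is positive semidefinite. -/
def QCM {ι : Type*} [Fintype ι] (Om V : Matrix ι ι ℝ) : Prop :=
  (V.map Complex.ofReal + Complex.I • Om.map Complex.ofReal).PosSemidef

/-- The positive semidefinite square root of a positive semidefinite real matrix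
(junk value `0` if the matrix is not positive semidefinite). -/
def msqrt {ι : Type*} [Fintype ι] [DecidableEq ι] (A : Matrix ι ι ℝ) : Matrix ι ι ℝ := by
  classical exact if h : A.PosSemidef then
    h.1.eigenvectorUnitary.1 * diagonal (RCLike.ofReal ∘ Real.sqrt ∘ h.1.eigenvalues) *
      (star h.1.eigenvectorUnitary : Matrix ι ι ℝ) else 0

/-- `g₋(A) = Σ_i max(−log ν_i, 0)` where `ν_1, …, ν_n` are the symplectic eigenvalues of `A`
(w.r.t. the symplectic form `Om`), i.e. the eigenvalues of the Hermitian matrix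
`i·√A·Om·√A` are exactly `±ν_1, …, ±ν_n`; equivalently, half the sum of
`max(−log |λ|, 0)` over all eigenvalues `λ` of `i·√A·Om·√A`. -/
def gMinus {ι : Type*} [Fintype ι] [DecidableEq ι] (Om A : Matrix ι ι ℝ) : ℝ := by
  classical exact
    if h : (Complex.I • ((msqrt A * Om * msqrt A).map Complex.ofReal)).IsHermitian then
      (∑ j, max (-Real.log |h.eigenvalues j|) 0) / 2
    else 0

/-- `g₊(A) = Σ_i max(log ν_i, 0)` where `ν_1, …, ν_n` are the symplectic eigenvalues of `A`
(w.r.t. the symplectic form `Om`). -/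
def gPlus {ι : Type*} [Fintype ι] [DecidableEq ι] (Om A : Matrix ι ι ℝ) : ℝ := by
  classical exact
    if h : (Complex.I • ((msqrt A * Om * msqrt A).map Complex.ofReal)).IsHermitian then
      (∑ j, max (Real.log |h.eigenvalues j|) 0) / 2
    else 0

/-- Schur complement of the first (upper-left) diagonal block of a block matrix:
`M/M₁₁ = M₂₂ − M₂₁ M₁₁⁻¹ M₁₂`. -/
def schurA {a b : Type*} [Fintype a] [DecidableEq a]
    (M : Matrix (a ⊕ b) (a ⊕ b) ℝ) : Matrix b b ℝ :=
  M.toBlocks₂₂ - M.toBlocks₂₁ * M.toBlocks₁₁⁻¹ * M.toBlocks₁₂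

/-- Schur complement of the second (lower-right) diagonal block of a block matrix:
`M/M₂₂ = M₁₁ − M₁₂ M₂₂⁻¹ M₂₁`. -/
def schurB {a b : Type*} [Fintype b] [DecidableEq b]
    (M : Matrix (a ⊕ b) (a ⊕ b) ℝ) : Matrix a a ℝ :=
  M.toBlocks₁₁ - M.toBlocks₁₂ * M.toBlocks₂₂⁻¹ * M.toBlocks₂₁

/-- Embedding of the `A ⊕ C` indices into `A ⊕ (B ⊕ C)`. -/
def embAC {a b c : Type*} : a ⊕ c → a ⊕ (b ⊕ c) :=
  Sum.elim Sum.inl (Sum.inr ∘ Sum.inr)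

/-- Embedding of the `A ⊕ B` indices into `A ⊕ (B ⊕ C)`. -/
def embAB {a b c : Type*} : a ⊕ b → a ⊕ (b ⊕ c) :=
  Sum.elim Sum.inl (Sum.inr ∘ Sum.inl)


/-- Spectral square root of a positive semidefinite matrix. -/
lemma sqrt_spec {𝕜 ι : Type*} [RCLike 𝕜] [Fintype ι] [DecidableEq ι] {A : Matrix ι ι 𝕜}
    (h : A.PosSemidef) :
    (h.1.eigenvectorUnitary.1 * diagonal (RCLike.ofReal ∘ Real.sqrt ∘ h.1.eigenvalues) *
      (star h.1.eigenvectorUnitary : Matrix ι ι 𝕜)).IsHermitian ∧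
    (h.1.eigenvectorUnitary.1 * diagonal (RCLike.ofReal ∘ Real.sqrt ∘ h.1.eigenvalues) *
      (star h.1.eigenvectorUnitary : Matrix ι ι 𝕜)) *
    (h.1.eigenvectorUnitary.1 * diagonal (RCLike.ofReal ∘ Real.sqrt ∘ h.1.eigenvalues) *
      (star h.1.eigenvectorUnitary : Matrix ι ι 𝕜)) = A := by
  have hU : (star h.1.eigenvectorUnitary : Matrix ι ι 𝕜) * h.1.eigenvectorUnitary.1 = 1 :=
    Unitary.coe_star_mul_self h.1.eigenvectorUnitary
  have hs := h.1.spectral_theorem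
  rw [Unitary.conjStarAlgAut_apply] at hs
  set U : Matrix ι ι 𝕜 := h.1.eigenvectorUnitary.1 with hUdef
  set D : Matrix ι ι 𝕜 := diagonal (RCLike.ofReal ∘ Real.sqrt ∘ h.1.eigenvalues) with hD
  have hDD : D * D = diagonal (RCLike.ofReal ∘ h.1.eigenvalues) := by
    rw [hD, diagonal_mul_diagonal]
    congr 1
    funext i
    simp only [Function.comp_apply]
    rw [← RCLike.ofReal_mul, Real.mul_self_sqrt (h.eigenvalues_nonneg i)]
  have hDH : Dᴴ = D := by
    rw [hD, diagonal_conjTranspose]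
    congr 1
    funext i
    simp
  constructor
  · simp only [Matrix.IsHermitian, star_eq_conjTranspose, conjTranspose_mul,
      conjTranspose_conjTranspose, hDH, Matrix.mul_assoc]
  · conv_rhs => rw [hs]
    rw [← hDD]
    calc U * D * star U * (U * D * star U) = U * D * (star U * U) * D * star U := by
          simp only [Matrix.mul_assoc]
      _ = _ := by rw [hU]; simp only [Matrix.mul_assoc, Matrix.one_mul]

lemma exists_herm_sqrt {𝕜 ι : Type*} [RCLike 𝕜] [Fintype ι] [DecidableEq ι] {A : Matrix ι ι 𝕜}
    (h : A.PosSemidef) : ∃ S : Matrix ι ι 𝕜, Sᴴ = S ∧ S * S = A :=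
  ⟨_, (sqrt_spec h).1, (sqrt_spec h).2⟩

lemma msqrt_spec {ι : Type*} [Fintype ι] [DecidableEq ι] {A : Matrix ι ι ℝ}
    (h : A.PosSemidef) : (msqrt A)ᴴ = msqrt A ∧ msqrt A * msqrt A = A := by
  have := sqrt_spec h
  unfold msqrt
  rw [dif_pos h]
  exact this

lemma one_le_det_one_add {ι : Type*} [Fintype ι] [DecidableEq ι] {M : Matrix ι ι ℂ}
    (h : M.PosSemidef) : 1 ≤ (1 + M).det := by
  have hU : (star h.1.eigenvectorUnitary : Matrix ι ι ℂ) * h.1.eigenvectorUnitary.1 = 1 :=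
    Unitary.coe_star_mul_self h.1.eigenvectorUnitary
  have hU' : h.1.eigenvectorUnitary.1 * (star h.1.eigenvectorUnitary : Matrix ι ι ℂ) = 1 :=
    Unitary.coe_mul_star_self h.1.eigenvectorUnitary
  have hs := h.1.spectral_theorem
  rw [Unitary.conjStarAlgAut_apply] at hs
  have e : (1 + M).det = ∏ i, ((1 + h.1.eigenvalues i : ℝ) : ℂ) := by
    have : 1 + M = h.1.eigenvectorUnitary.1 *
        diagonal (fun i => ((1 + h.1.eigenvalues i : ℝ) : ℂ)) *
        (star h.1.eigenvectorUnitary : Matrix ι ι ℂ) := by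
      have : diagonal (fun i => ((1 + h.1.eigenvalues i : ℝ) : ℂ)) =
          1 + diagonal (RCLike.ofReal ∘ h.1.eigenvalues) := by
        rw [← diagonal_one, diagonal_add]
        congr 1
        funext i
        simp
      rw [this, Matrix.mul_add, Matrix.add_mul, Matrix.mul_one, hU']
      congr 1
    rw [this, det_mul_right_comm, hU', Matrix.one_mul, det_diagonal]
  rw [e, ← Complex.ofReal_prod]
  have : (1 : ℝ) ≤ ∏ i, (1 + h.1.eigenvalues i) :=
    calc (1 : ℝ) = ∏ _i : ι, (1 : ℝ) := by simp
      _ ≤ _ := Finset.prod_le_prod (fun _ _ => zero_le_one)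
        fun i _ => by linarith [h.eigenvalues_nonneg i]
  exact_mod_cast this

lemma det_mono {ι : Type*} [Fintype ι] [DecidableEq ι] {A B : Matrix ι ι ℂ}
    (hA : A.PosSemidef) (hAB : (B - A).PosSemidef) : A.det ≤ B.det := by
  have hB : B.PosSemidef := by
    have := hA.add hAB
    simpa using this
  by_cases h0 : A.det = 0
  · rw [h0]; exact hB.det_nonneg
  obtain ⟨S, hS, hSS⟩ := exists_herm_sqrt hA
  have hSu : IsUnit S.det := by
    rw [isUnit_iff_ne_zero]
    intro h
    apply h0
    rw [← hSS, det_mul, h, zero_mul]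
  have hE : (S⁻¹ * (B - A) * S⁻¹).PosSemidef := by
    have := hAB.conjTranspose_mul_mul_same S⁻¹
    rwa [conjTranspose_nonsing_inv, hS] at this
  have e : B = S * (1 + S⁻¹ * (B - A) * S⁻¹) * S := by
    have h1 : S * (S⁻¹ * (B - A) * S⁻¹) * S = B - A := by
      calc S * (S⁻¹ * (B - A) * S⁻¹) * S = (S * S⁻¹) * (B - A) * (S⁻¹ * S) := by
            simp only [Matrix.mul_assoc]
        _ = _ := by rw [mul_nonsing_inv _ hSu, nonsing_inv_mul _ hSu]; simp
    rw [Matrix.mul_add, Matrix.add_mul, h1, Matrix.mul_one, hSS]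
    abel
  have e2 : B.det = A.det * (1 + S⁻¹ * (B - A) * S⁻¹).det := by
    conv_lhs => rw [e]
    rw [← hSS, det_mul, det_mul, det_mul]; ring
  rw [e2]
  have := mul_le_mul_of_nonneg_left (one_le_det_one_add hE) hA.det_nonneg
  simpa using this

lemma posSemidef_one_sub {n s : Type*} [Fintype n] [DecidableEq n] [Fintype s] [DecidableEq s]
    {Q : Matrix n s ℂ} (hQ : Qᴴ * Q = 1) : (1 - Q * Qᴴ).PosSemidef := by
  have : 1 - Q * Qᴴ = (1 - Q * Qᴴ)ᴴ * (1 - Q * Qᴴ) := by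
    have h1 : Q * Qᴴ * (Q * Qᴴ) = Q * Qᴴ := by
      calc Q * Qᴴ * (Q * Qᴴ) = Q * (Qᴴ * Q) * Qᴴ := by simp only [Matrix.mul_assoc]
        _ = _ := by rw [hQ, Matrix.mul_one]
    rw [conjTranspose_sub, conjTranspose_mul, conjTranspose_conjTranspose, conjTranspose_one,
      Matrix.mul_sub, Matrix.sub_mul, Matrix.sub_mul, h1]
    simp
  rw [this]
  exact posSemidef_conjTranspose_mul_self _

lemma det_compress_le {n s : Type*} [Fintype n] [DecidableEq n] [Fintype s] [DecidableEq s]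
    {Q : Matrix n s ℂ} (hQ : Qᴴ * Q = 1) {L : Matrix n n ℂ} (hL : (L - 1).PosSemidef) :
    (Qᴴ * L * Q).det ≤ L.det := by
  obtain ⟨T, hT, hTT⟩ := exists_herm_sqrt hL
  have e : L = 1 + T * T := by rw [hTT]; abel
  have e1 : Qᴴ * L * Q = 1 + (Qᴴ * T) * (T * Q) := by
    rw [e, Matrix.mul_add, Matrix.add_mul, Matrix.mul_one, hQ]
    simp only [Matrix.mul_assoc]
  rw [e1, det_one_add_mul_comm, e]
  apply det_mono
  · apply Matrix.PosSemidef.add Matrix.PosSemidef.one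
    have := posSemidef_self_mul_conjTranspose (T * Q)
    rwa [conjTranspose_mul, hT] at this
  · have := (posSemidef_one_sub hQ).conjTranspose_mul_mul_same T
    convert this using 1
    rw [hT, Matrix.mul_sub, Matrix.sub_mul]
    simp only [Matrix.mul_assoc, Matrix.mul_one]
    abel

lemma normSq_det_le {n s : Type*} [Fintype n] [DecidableEq n] [Fintype s] [DecidableEq s]
    {Q : Matrix n s ℂ} (hQ : Qᴴ * Q = 1) (κ : n → ℝ) :
    ‖(Qᴴ * diagonal (fun i => (κ i : ℂ)) * Q).det‖ ≤ ∏ i, max 1 |κ i| := by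
  set K : Matrix n n ℂ := diagonal (fun i => (κ i : ℂ)) with hK
  set L : Matrix n n ℂ := diagonal (fun i => (((max 1 |κ i|) ^ 2 : ℝ) : ℂ)) with hL
  have hKH : Kᴴ = K := by
    rw [hK, diagonal_conjTranspose]
    congr 1
    funext i
    simp
  have hL1 : (L - 1).PosSemidef := by
    rw [hL, ← diagonal_one, diagonal_sub]
    apply PosSemidef.diagonal
    intro i
    have : (0 : ℝ) ≤ (max 1 |κ i|) ^ 2 - 1 := by nlinarith [le_max_left 1 |κ i|]
    simp only [Pi.zero_apply]
    exact_mod_cast this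
  have hLK : (L - K * K).PosSemidef := by
    rw [hL, hK, diagonal_mul_diagonal, diagonal_sub]
    apply PosSemidef.diagonal
    intro i
    have : (0 : ℝ) ≤ (max 1 |κ i|) ^ 2 - κ i * κ i := by
      nlinarith [le_max_right 1 |κ i|, abs_nonneg (κ i), abs_mul_abs_self (κ i)]
    simp only [Pi.zero_apply]
    exact_mod_cast this
  have h1 : ((Qᴴ * K * Q)ᴴ * (Qᴴ * K * Q)).det ≤ (Qᴴ * L * Q).det := by
    apply det_mono (posSemidef_conjTranspose_mul_self _)
    have a1 := hLK.conjTranspose_mul_mul_same Q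
    have a2 := (posSemidef_one_sub hQ).conjTranspose_mul_mul_same (K * Q)
    convert a1.add a2 using 1
    simp only [conjTranspose_mul, conjTranspose_conjTranspose, hKH, Matrix.mul_sub, Matrix.sub_mul,
      Matrix.mul_assoc, Matrix.mul_one, Matrix.one_mul]
    abel
  have h2 := h1.trans (det_compress_le hQ hL1)
  rw [det_mul, det_conjTranspose, hL, det_diagonal, ← Complex.ofReal_prod] at h2
  have h3 : star (Qᴴ * K * Q).det * (Qᴴ * K * Q).det = ((‖(Qᴴ * K * Q).det‖ ^ 2 : ℝ) : ℂ) := by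
    rw [Complex.star_def, Complex.conj_mul']
    push_cast; rfl
  rw [h3, Complex.real_le_real, Finset.prod_pow] at h2
  exact le_of_sq_le_sq h2 (Finset.prod_nonneg fun i _ => by positivity)

lemma det_le_one_of_diag {s : Type*} [Fintype s] [DecidableEq s] {G : Matrix s s ℂ}
    (hG : G.PosSemidef) (hd : ∀ i, G i i = 1) : ‖G.det‖ ≤ 1 := by
  have ht : G.trace = (Fintype.card s : ℂ) := by simp [Matrix.trace, hd]
  rw [hG.1.trace_eq_sum_eigenvalues] at ht
  have ht' : ∑ i, (hG.1.eigenvalues i - 1) = 0 := by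
    rw [Finset.sum_sub_distrib]
    have : ∑ i, hG.1.eigenvalues i = (Fintype.card s : ℝ) := by
      apply Complex.ofReal_injective
      push_cast
      exact ht
    rw [this]; simp
  rw [hG.1.det_eq_prod_eigenvalues, norm_prod]
  calc ∏ i, ‖((hG.1.eigenvalues i : ℝ) : ℂ)‖ ≤ ∏ i, Real.exp (hG.1.eigenvalues i - 1) := by
        apply Finset.prod_le_prod
        · intro i _; positivity
        · intro i _
          rw [Complex.norm_real, Real.norm_eq_abs, abs_of_nonneg (hG.eigenvalues_nonneg i)]
          have := Real.add_one_le_exp (hG.1.eigenvalues i - 1)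
          linarith
    _ = 1 := by rw [← Real.exp_sum, ht', Real.exp_zero]

lemma norm_det_pencil_le {n s : Type*} [Fintype n] [DecidableEq n] [Fintype s] [DecidableEq s]
    {Z : Matrix n s ℂ} (hd : ∀ i, (Zᴴ * Z) i i = 1) (hdet : (Zᴴ * Z).det ≠ 0) (κ : n → ℝ) :
    ‖(Zᴴ * diagonal (fun i => (κ i : ℂ)) * Z).det‖ ≤ ∏ i, max 1 |κ i| := by
  have hG := posSemidef_conjTranspose_mul_self Z
  obtain ⟨S, hS, hSS⟩ := exists_herm_sqrt hG
  have hSu : IsUnit S.det := by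
    rw [isUnit_iff_ne_zero]
    intro h
    apply hdet
    rw [← hSS, det_mul, h, zero_mul]
  have hQ : (Z * S⁻¹)ᴴ * (Z * S⁻¹) = 1 := by
    calc (Z * S⁻¹)ᴴ * (Z * S⁻¹) = S⁻¹ * (Zᴴ * Z) * S⁻¹ := by
          rw [conjTranspose_mul, conjTranspose_nonsing_inv, hS]
          simp only [Matrix.mul_assoc]
      _ = (S⁻¹ * S) * (S * S⁻¹) := by rw [← hSS]; simp only [Matrix.mul_assoc]
      _ = 1 := by rw [mul_nonsing_inv _ hSu, nonsing_inv_mul _ hSu, Matrix.one_mul]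
  have h1 := normSq_det_le hQ κ
  have h2 := det_le_one_of_diag hG hd
  set D := diagonal (fun i => (κ i : ℂ)) with hD
  have e : Zᴴ * D * Z = S * ((Z * S⁻¹)ᴴ * D * (Z * S⁻¹)) * S := by
    rw [conjTranspose_mul, conjTranspose_nonsing_inv, hS]
    calc Zᴴ * D * Z = (S * S⁻¹) * (Zᴴ * D * Z) * (S⁻¹ * S) := by
          rw [mul_nonsing_inv _ hSu, nonsing_inv_mul _ hSu]; simp
      _ = _ := by simp only [Matrix.mul_assoc]
  rw [e, det_mul, det_mul]
  rw [← hSS, det_mul, norm_mul] at h2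
  rw [norm_mul, norm_mul]
  calc _ = (‖S.det‖ * ‖S.det‖) * ‖((Z * S⁻¹)ᴴ * D * (Z * S⁻¹)).det‖ := by ring
    _ ≤ 1 * ∏ i, max 1 |κ i| := by gcongr
    _ = _ := one_mul _

lemma gMinus_spec {ι : Type*} [Fintype ι] [DecidableEq ι] {Om A : Matrix ι ι ℝ}
    (hA : A.PosDef) (hT : Omᵀ = -Om) (hsq : Om * Om = -1) :
    ∃ (X : Matrix ι ι ℂ) (κ : ι → ℝ), Xᴴ * A.map Complex.ofReal * X = 1 ∧
      Xᴴ * (Complex.I • Om.map Complex.ofReal) * X = diagonal (fun i => (κ i : ℂ)) ∧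
      gMinus Om A = (∑ i, max (Real.log |κ i|) 0) / 2 := by
  obtain ⟨hR, hRR⟩ := msqrt_spec hA.posSemidef
  set R := (msqrt A).map Complex.ofReal with hRdef
  set O := Complex.I • Om.map Complex.ofReal with hO
  have cmul : ∀ M N : Matrix ι ι ℝ,
      (M * N).map Complex.ofReal = M.map Complex.ofReal * N.map Complex.ofReal := fun M N =>
    Matrix.map_mul (f := Complex.ofRealHom)
  have hRH : Rᴴ = R := by
    ext i j
    have := congrFun (congrFun hR i) j
    simp only [conjTranspose_apply, star_trivial] at this
    simp [hRdef, this]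
  have hRRc : R * R = A.map Complex.ofReal := by rw [hRdef, ← cmul, hRR]
  have hOH : Oᴴ = O := by
    ext i j
    have := congrFun (congrFun hT i) j
    simp only [transpose_apply, neg_apply] at this
    simp [hO, this]
  have hOO : O * O = 1 := by
    rw [hO, Matrix.smul_mul, Matrix.mul_smul, smul_smul, Complex.I_mul_I, ← cmul, hsq]
    ext i j
    by_cases h : i = j <;> simp [h, Matrix.one_apply]
  have hRu : IsUnit R.det := by
    rw [isUnit_iff_ne_zero]
    intro h
    have h1 : (A.map Complex.ofReal).det = 0 := by rw [← hRRc, det_mul, h, zero_mul]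
    have h2 : (A.map Complex.ofReal).det = ((A.det : ℝ) : ℂ) :=
      (RingHom.map_det Complex.ofRealHom A).symm
    rw [h2] at h1
    exact hA.det_pos.ne' (by exact_mod_cast h1)
  have eH : Complex.I • ((msqrt A * Om * msqrt A).map Complex.ofReal) = R * O * R := by
    rw [cmul, cmul, hO, Matrix.mul_smul, Matrix.smul_mul]
  have hH : (Complex.I • ((msqrt A * Om * msqrt A).map Complex.ofReal)).IsHermitian := by
    rw [eH, Matrix.IsHermitian, conjTranspose_mul, conjTranspose_mul, hRH, hOH, Matrix.mul_assoc]
  have hU : (star hH.eigenvectorUnitary : Matrix ι ι ℂ) * hH.eigenvectorUnitary.1 = 1 :=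
    Unitary.coe_star_mul_self hH.eigenvectorUnitary
  have hU' : hH.eigenvectorUnitary.1 * (star hH.eigenvectorUnitary : Matrix ι ι ℂ) = 1 :=
    Unitary.coe_mul_star_self hH.eigenvectorUnitary
  have hs := hH.conjStarAlgAut_star_eigenvectorUnitary
  rw [Unitary.conjStarAlgAut_star_apply] at hs
  have hg : gMinus Om A = (∑ j, max (-Real.log |hH.eigenvalues j|) 0) / 2 := by
    unfold gMinus
    rw [dif_pos hH]
  set h := hH.eigenvalues with hh
  set U : Matrix ι ι ℂ := hH.eigenvectorUnitary.1 with hUd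
  rw [star_eq_conjTranspose] at hU hU' hs
  rw [eH] at hs
  have hXH : (R⁻¹ * U)ᴴ = Uᴴ * R⁻¹ := by
    rw [conjTranspose_mul, conjTranspose_nonsing_inv, hRH]
  have i1 := mul_nonsing_inv _ hRu
  have i2 := nonsing_inv_mul _ hRu
  have key : (Uᴴ * R⁻¹ * O * (R⁻¹ * U)) * diagonal (RCLike.ofReal ∘ h) = 1 := by
    rw [← hs]
    calc (Uᴴ * R⁻¹ * O * (R⁻¹ * U)) * (Uᴴ * (R * O * R) * U)
        = Uᴴ * R⁻¹ * O * R⁻¹ * (U * Uᴴ) * R * O * R * U := by simp only [Matrix.mul_assoc]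
      _ = Uᴴ * R⁻¹ * O * (R⁻¹ * R) * O * R * U := by
          rw [hU']; simp only [Matrix.mul_assoc, Matrix.one_mul]
      _ = Uᴴ * R⁻¹ * (O * O) * R * U := by
          rw [i2]; simp only [Matrix.mul_assoc, Matrix.one_mul]
      _ = Uᴴ * (R⁻¹ * R) * U := by
          rw [hOO]; simp only [Matrix.mul_assoc, Matrix.one_mul]
      _ = 1 := by rw [i2, Matrix.mul_one, hU]
  have hne : ∀ i, (h i : ℂ) ≠ 0 := by
    have := congrArg Matrix.det key
    rw [det_mul, det_one, det_diagonal] at this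
    have h2 := right_ne_zero_of_mul_eq_one this
    intro i
    exact Finset.prod_ne_zero_iff.mp h2 i (Finset.mem_univ i)
  refine ⟨R⁻¹ * U, fun i => (h i)⁻¹, ?_, ?_, ?_⟩
  · rw [hXH, ← hRRc]
    calc Uᴴ * R⁻¹ * (R * R) * (R⁻¹ * U) = Uᴴ * (R⁻¹ * R) * (R * R⁻¹) * U := by
          simp only [Matrix.mul_assoc]
      _ = 1 := by rw [i1, i2, Matrix.mul_one, Matrix.mul_one, hU]
  · rw [hXH]
    have hDD : diagonal (RCLike.ofReal ∘ h) * diagonal (fun i => (((h i)⁻¹ : ℝ) : ℂ)) = 1 := by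
      rw [diagonal_mul_diagonal, ← diagonal_one]
      congr 1
      funext i
      have := hne i
      simp [this]
    calc _ = (Uᴴ * R⁻¹ * O * (R⁻¹ * U)) * (diagonal (RCLike.ofReal ∘ h) *
          diagonal (fun i => (((h i)⁻¹ : ℝ) : ℂ))) := by rw [hDD, Matrix.mul_one]
      _ = _ := by rw [← Matrix.mul_assoc, key, Matrix.one_mul]
  · rw [hg]
    congr 1
    apply Finset.sum_congr rfl
    intro i _
    rw [abs_inv, Real.log_inv]

lemma log_max_one (x : ℝ) : Real.log (max 1 |x|) = max (Real.log |x|) 0 := by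
  rcases le_total 1 |x| with h | h
  · rw [max_eq_right h, max_eq_left (Real.log_nonneg h)]
  · rw [max_eq_left h, Real.log_one, max_eq_right (Real.log_nonpos (abs_nonneg x) h)]

lemma gMinus_pinch {k : ℕ} {β : Fin k → Type} [∀ j, Fintype (β j)] [∀ j, DecidableEq (β j)]
    (Om : ∀ j, Matrix (β j) (β j) ℝ) (hT : ∀ j, (Om j)ᵀ = -Om j) (hsq : ∀ j, Om j * Om j = -1)
    (W : Matrix ((j : Fin k) × β j) ((j : Fin k) × β j) ℝ) (hW : W.PosDef) :
    ∑ j, gMinus (Om j) (W.submatrix (Sigma.mk j) (Sigma.mk j)) ≤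
      gMinus (blockDiagonal' Om) W := by
  have hTb : (blockDiagonal' Om)ᵀ = -blockDiagonal' Om := by
    rw [blockDiagonal'_transpose, ← blockDiagonal'_neg]
    congr 1
    funext j
    exact hT j
  have hsqb : blockDiagonal' Om * blockDiagonal' Om = -1 := by
    rw [← blockDiagonal'_mul, ← blockDiagonal'_one, ← blockDiagonal'_neg]
    congr 1
    funext j
    exact hsq j
  have hsub : ∀ j, (W.submatrix (Sigma.mk j) (Sigma.mk j)).PosDef := fun j =>
    hW.submatrix sigma_mk_injective
  choose X κ hX1 hX2 hX3 using fun j => gMinus_spec (hsub j) (hT j) (hsq j)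
  obtain ⟨Y, μ, hY1, hY2, hY3⟩ := gMinus_spec hW hTb hsqb
  rw [hY3]
  simp only [hX3]
  rw [← Finset.sum_div]
  apply div_le_div_of_nonneg_right _ (by norm_num : (0 : ℝ) ≤ 2)
  rw [← Fintype.sum_sigma' (fun j i => max (Real.log |κ j i|) 0)]
  set s := {p : (j : Fin k) × β j // 1 < |κ p.1 p.2|} with hs
  set XX := blockDiagonal' X with hXX
  set Xs : Matrix ((j : Fin k) × β j) s ℂ := XX.submatrix id Subtype.val with hXs
  set Wc := W.map Complex.ofReal with hWc
  set Oc := Complex.I • (blockDiagonal' Om).map Complex.ofReal with hOc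
  have hYu : IsUnit Y.det := by
    have := congrArg Matrix.det hY1
    rw [det_mul, det_one] at this
    exact isUnit_iff_ne_zero.mpr (right_ne_zero_of_mul_eq_one this)
  have j1 := mul_nonsing_inv _ hYu
  have j2 := nonsing_inv_mul _ hYu
  have j1H : (Y⁻¹)ᴴ * Yᴴ = 1 := by rw [← conjTranspose_mul, j1, conjTranspose_one]
  set Z := Y⁻¹ * Xs with hZ
  have hconj : ∀ M : Matrix ((j : Fin k) × β j) ((j : Fin k) × β j) ℂ,
      Zᴴ * (Yᴴ * M * Y) * Z = Xsᴴ * M * Xs := by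
    intro M
    rw [hZ, conjTranspose_mul]
    calc Xsᴴ * (Y⁻¹)ᴴ * (Yᴴ * M * Y) * (Y⁻¹ * Xs)
        = Xsᴴ * ((Y⁻¹)ᴴ * Yᴴ) * M * (Y * Y⁻¹) * Xs := by simp only [Matrix.mul_assoc]
      _ = _ := by rw [j1, j1H, Matrix.mul_one, Matrix.mul_one]
  have hXsM : ∀ M : Matrix ((j : Fin k) × β j) ((j : Fin k) × β j) ℂ,
      Xsᴴ * M * Xs = (XXᴴ * M * XX).submatrix Subtype.val Subtype.val := by
    intro M
    ext a b
    simp [hXs, Matrix.mul_apply]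
  have hG : Zᴴ * Z = (XXᴴ * Wc * XX).submatrix Subtype.val Subtype.val := by
    rw [← hXsM, ← hconj, hY1, Matrix.mul_one]
  have hD : Zᴴ * diagonal (fun i => (μ i : ℂ)) * Z
      = diagonal (fun p : s => ((κ p.1.1 p.1.2 : ℝ) : ℂ)) := by
    rw [← hY2, hconj, hXsM]
    have : XXᴴ * Oc * XX = diagonal (fun p => ((κ p.1 p.2 : ℝ) : ℂ)) := by
      have e1 : Oc = blockDiagonal' (fun j => Complex.I • (Om j).map Complex.ofReal) := by
        rw [hOc, blockDiagonal'_map _ _ Complex.ofReal_zero, ← blockDiagonal'_smul]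
        rfl
      rw [e1, hXX, blockDiagonal'_conjTranspose, ← blockDiagonal'_mul, ← blockDiagonal'_mul,
        ← blockDiagonal'_diagonal (fun j i => ((κ j i : ℝ) : ℂ))]
      congr 1
      funext j
      exact hX2 j
    rw [this, submatrix_diagonal _ _ Subtype.val_injective]
    rfl
  have hdiag : ∀ p, (XXᴴ * Wc * XX) p p = 1 := by
    rintro ⟨j, i⟩
    have := congrFun (congrFun (hX1 j) i) i
    rw [Matrix.one_apply_eq] at this
    rw [← this]
    simp only [Matrix.mul_apply, Fintype.sum_sigma, conjTranspose_apply, hXX, Finset.sum_mul]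
    rw [Finset.sum_eq_single j, Finset.sum_congr rfl, ]
    · intro x _
      rw [Finset.sum_eq_single j]
      · simp [blockDiagonal'_apply_eq, hWc]
      · intro j' _ hj'
        simp [blockDiagonal'_apply_ne _ _ _ hj']
      · simp
    · intro j' _ hj'
      simp [blockDiagonal'_apply_ne _ _ _ hj']
    · simp
  have hXXu : XX.det ≠ 0 := by
    have h1 : blockDiagonal' (fun j => (X j)ᴴ *
        (W.submatrix (Sigma.mk j) (Sigma.mk j)).map Complex.ofReal) * XX = 1 := by
      rw [hXX, ← blockDiagonal'_mul, ← blockDiagonal'_one]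
      congr 1
      funext j
      exact hX1 j
    have := congrArg Matrix.det h1
    rw [det_mul, det_one] at this
    exact right_ne_zero_of_mul_eq_one this
  have hdet : (Zᴴ * Z).det ≠ 0 := by
    have hWpd : (XXᴴ * Wc * XX).PosDef := by
      have h1 : XXᴴ * Wc * XX = (Y⁻¹ * XX)ᴴ * (Y⁻¹ * XX) := by
        have : Wc = (Y⁻¹)ᴴ * Y⁻¹ := by
          calc Wc = ((Y⁻¹)ᴴ * Yᴴ) * Wc * (Y * Y⁻¹) := by
                rw [j1, j1H, Matrix.mul_one, Matrix.one_mul]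
            _ = (Y⁻¹)ᴴ * (Yᴴ * Wc * Y) * Y⁻¹ := by simp only [Matrix.mul_assoc]
            _ = _ := by rw [hY1, Matrix.mul_one]
        rw [this, conjTranspose_mul]
        simp only [Matrix.mul_assoc]
      have h2 : (XXᴴ * Wc * XX).PosSemidef := by
        rw [h1]; exact posSemidef_conjTranspose_mul_self _
      rw [h2.posDef_iff_det_ne_zero, h1, det_mul, det_conjTranspose, det_mul]
      have hy : Y⁻¹.det ≠ 0 := by
        intro h0
        have := congrArg Matrix.det j1
        rw [det_mul, h0] at this
        simp at this
      exact mul_ne_zero (star_ne_zero.mpr (mul_ne_zero hy hXXu)) (mul_ne_zero hy hXXu)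
    rw [hG]
    exact (hWpd.submatrix Subtype.val_injective).det_pos.ne'
  have main := norm_det_pencil_le (Z := Z) (fun i => by rw [hG]; exact hdiag _) hdet μ
  rw [hD, det_diagonal, norm_prod] at main
  have hpos : 0 < ∏ p : s, ‖((κ p.1.1 p.1.2 : ℝ) : ℂ)‖ := by
    apply Finset.prod_pos
    rintro ⟨p, hp⟩ _
    rw [Complex.norm_real, Real.norm_eq_abs]
    linarith
  have hlog := Real.log_le_log hpos main
  have hmax : ∀ i ∈ Finset.univ, max 1 |μ i| ≠ 0 := fun i _ => by
    have := le_max_left 1 |μ i|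
    linarith
  have hnz : ∀ p ∈ (Finset.univ : Finset s), ‖((κ p.1.1 p.1.2 : ℝ) : ℂ)‖ ≠ 0 := by
    rintro ⟨p, hp⟩ _
    rw [Complex.norm_real, Real.norm_eq_abs]
    intro h0
    rw [h0] at hp
    linarith
  rw [Real.log_prod hnz, Real.log_prod hmax] at hlog
  · simp only [log_max_one] at hlog
    refine le_trans (le_of_eq ?_) hlog
    have : ∀ p : (j : Fin k) × β j, max (Real.log |κ p.1 p.2|) 0 =
        if 1 < |κ p.1 p.2| then Real.log |κ p.1 p.2| else 0 := by
      intro p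
      split_ifs with hp
      · exact max_eq_left (Real.log_nonneg hp.le)
      · exact max_eq_right (Real.log_nonpos (abs_nonneg _) (not_lt.mp hp))
    simp only [this, Complex.norm_real, Real.norm_eq_abs]
    rw [← Finset.sum_filter]
    exact (Finset.sum_subtype _ (by simp) _)

lemma Omega_transpose (n : ℕ) : (Omega n)ᵀ = -Omega n := by
  ext ⟨a, i⟩ ⟨b, j⟩
  by_cases h : a = b
  · subst h
    fin_cases i <;> fin_cases j <;> simp [Omega, J2]
  · have h' : b ≠ a := fun e => h e.symm
    simp [Omega, Matrix.one_apply, h, h']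

lemma Omega_sq (n : ℕ) : Omega n * Omega n = -1 := by
  rw [Omega, ← mul_kronecker_mul, Matrix.one_mul]
  have : J2 * J2 = -1 := by
    ext i j
    fin_cases i <;> fin_cases j <;> simp [J2]
  rw [this]
  ext ⟨a, i⟩ ⟨b, j⟩
  by_cases h1 : a = b <;> by_cases h2 : i = j <;> simp [Matrix.one_apply, h1, h2]

lemma schurA_posDef {a b : Type*} [Fintype a] [DecidableEq a] [Fintype b] [DecidableEq b]
    {M : Matrix (a ⊕ b) (a ⊕ b) ℝ} (hM : M.PosDef) : (schurA M).PosDef := by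
  have hA : M.toBlocks₁₁.PosDef := hM.submatrix Sum.inl_injective
  have h21 : M.toBlocks₂₁ = M.toBlocks₁₂ᴴ := by
    ext i j
    exact (hM.1.apply (Sum.inr i) (Sum.inl j)).symm
  have hu : IsUnit M.toBlocks₁₁ := hA.isUnit
  letI : Invertible M.toBlocks₁₁ := hu.invertible
  have hps : (schurA M).PosSemidef := by
    unfold schurA
    rw [h21]
    apply (Matrix.PosDef.fromBlocks₁₁ M.toBlocks₁₂ M.toBlocks₂₂ hA).1
    rw [← h21, fromBlocks_toBlocks]
    exact hM.posSemidef
  rw [hps.posDef_iff_det_ne_zero]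
  intro h0
  have := hM.det_pos
  rw [← fromBlocks_toBlocks M, det_fromBlocks₁₁, invOf_eq_nonsing_inv] at this
  unfold schurA at h0
  rw [h0] at this
  simp at this

/-- **Monogamy of Gaussian steerability w.r.t. the steering party.**
For a real symmetric positive definite quantum covariance matrix `V` on
`A ⊕ (B₁ ⊕ ⋯ ⊕ B_k)` (with `B_j` of `m j` modes, and `V + i·Ω ≥ 0` for the direct sum
`Ω` of the standard symplectic forms), one has
`g₋(V/V_A) ≥ Σ_j g₋(V_{AB_j}/V_A)`, i.e. `G(A⟩B₁…B_k) ≥ Σ_j G(A⟩B_j)`. -/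
theorem steerability_monogamy_steering_party (nA k : ℕ) (m : Fin k → ℕ)
    (V : Matrix ((Fin nA × Fin 2) ⊕ ((j : Fin k) × (Fin (m j) × Fin 2)))
        ((Fin nA × Fin 2) ⊕ ((j : Fin k) × (Fin (m j) × Fin 2))) ℝ)
    (hVsymm : V.IsSymm) (hVpd : V.PosDef)
    (hQCM : QCM
      (fromBlocks (Omega nA) 0 0 (blockDiagonal' fun j => Omega (m j))) V) :
    ∑ j : Fin k,
        gMinus (Omega (m j))
          (schurA (V.submatrix
            (Sum.map id fun x => (⟨j, x⟩ : (j : Fin k) × (Fin (m j) × Fin 2)))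
            (Sum.map id fun x => (⟨j, x⟩ : (j : Fin k) × (Fin (m j) × Fin 2)))))
      ≤ gMinus (blockDiagonal' fun j => Omega (m j)) (schurA V) := by
  exact gMinus_pinch (fun j => Omega (m j)) (fun j => Omega_transpose _) (fun j => Omega_sq _)
    (schurA V) (schurA_posDef hVpd)

end
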